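/- Let X be a completely metrizable topological space, K ⊆ X a closed subset, and d_K a complete metric on K compatible with the subspace topology of K such that K has finite diameter with respect to d_K. Then there exists a complete metric d on X compatible with the topology of X whose restriction to K × K equals d_K. -/

import Mathlib

open Filter Topology

/-- The function `p` satisfies the axioms of a pseudometric. -/
structure IsPseudoMetric {X : Type*} (p : X → X → ℝ) : Prop where
  self : ∀ x, p x x = 0
  comm : ∀ x y, p x y = p y x
  triangle : ∀ x y z, p x z ≤ p x y + p y z

theorem IsPseudoMetric.nonneg {X : Type*} {p : X → X → ℝ} (hp : IsPseudoMetric p) (x y : X) :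
    0 ≤ p x y := by
  linarith [hp.self x, hp.comm x y, hp.triangle x y x]

/-- The extension of the function `e a : K → ℝ` to the whole space by the infimum formula of
Hausdorff. -/
noncomputable def hausdorffExtend {X : Type*} [MetricSpace X] (K : Set X) (e : K → K → ℝ)
    (a : K) (x : X) : ℝ :=
  open Classical in
  if h : x ∈ K then e a ⟨x, h⟩
  else ⨅ y : K, (e a y + (dist x y / Metric.infDist x K - 1))

section hausdorffExtend

variable {X : Type*} [MetricSpace X] {K : Set X} {e : K → K → ℝ} {C : ℝ}

theorem hausdorffExtend_coe (a y : K) : hausdorffExtend K e a y = e a y := by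
  simp [hausdorffExtend]

theorem one_le_dist_div_infDist {x : X} (hx : 0 < Metric.infDist x K) (y : K) :
    1 ≤ dist x y / Metric.infDist x K := by
  rw [le_div_iff₀ hx, one_mul]
  exact Metric.infDist_le_dist_of_mem y.2

theorem hausdorffExtend_le (h0 : ∀ x y, 0 ≤ e x y) (a : K) {x : X}
    (hx : 0 < Metric.infDist x K) (hxK : x ∉ K) (y : K) :
    hausdorffExtend K e a x ≤ e a y + (dist x y / Metric.infDist x K - 1) := by
  rw [hausdorffExtend, dif_neg hxK]
  refine ciInf_le ⟨0, ?_⟩ y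
  rintro _ ⟨z, rfl⟩
  have := one_le_dist_div_infDist hx z
  have := h0 a z
  dsimp only
  linarith

theorem le_hausdorffExtend (hne : K.Nonempty) (a : K) {x : X} (hxK : x ∉ K) {b : ℝ}
    (hb : ∀ y : K, b ≤ e a y + (dist x y / Metric.infDist x K - 1)) :
    b ≤ hausdorffExtend K e a x := by
  rw [hausdorffExtend, dif_neg hxK]
  have := hne.to_subtype
  exact le_ciInf hb

theorem exists_dist_div_infDist_lt {x : X} (hne : K.Nonempty) (hx : 0 < Metric.infDist x K)
    {η : ℝ} (hη : 0 < η) : ∃ y : K, dist x y < (1 + η) * Metric.infDist x K ∧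
      dist x y / Metric.infDist x K - 1 < η := by
  obtain ⟨y, hy, hxy⟩ := (Metric.infDist_lt_iff (x := x)
    (r := (1 + η) * Metric.infDist x K) hne).1 (by nlinarith)
  refine ⟨⟨y, hy⟩, hxy, ?_⟩
  have := (div_lt_iff₀ hx).2 hxy
  simp only
  linarith

theorem hausdorffExtend_mem_Icc (hK : IsClosed K) (hne : K.Nonempty) (h0 : ∀ x y, 0 ≤ e x y)
    (hC : ∀ x y, e x y ≤ C) (a : K) (x : X) :
    0 ≤ hausdorffExtend K e a x ∧ hausdorffExtend K e a x ≤ C + 1 := by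
  by_cases hxK : x ∈ K
  · have h := hausdorffExtend_coe (e := e) a ⟨x, hxK⟩
    simp only at h
    rw [h]
    exact ⟨h0 _ _, by linarith [hC a ⟨x, hxK⟩]⟩
  · have hx := (hK.notMem_iff_infDist_pos hne).1 hxK
    constructor
    · refine le_hausdorffExtend hne a hxK fun y => ?_
      linarith [one_le_dist_div_infDist hx y, h0 a y]
    · obtain ⟨y, -, hy⟩ := exists_dist_div_infDist_lt hne hx one_pos
      linarith [hausdorffExtend_le h0 a hx hxK y, hC a y]

theorem hausdorffExtend_le_add (hK : IsClosed K) (hne : K.Nonempty) (h0 : ∀ x y, 0 ≤ e x y)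
    (hC : ∀ x y, e x y ≤ C) (a : K) {x x' : X} (hx : 0 < Metric.infDist x K)
    (hxx' : dist x x' ≤ Metric.infDist x K / 2) :
    hausdorffExtend K e a x' ≤
      hausdorffExtend K e a x + 2 * dist x x' * (C + 3) / Metric.infDist x K := by
  have hC0 : 0 ≤ C := (h0 a a).trans (hC a a)
  have hd : (0 : ℝ) ≤ dist x x' := dist_nonneg
  have hxK := (hK.notMem_iff_infDist_pos hne).2 hx
  have hh : Metric.infDist x K ≤ Metric.infDist x' K + dist x x' :=
    Metric.infDist_le_infDist_add_dist
  have hx' : 0 < Metric.infDist x' K := by linarith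
  have hx'K := (hK.notMem_iff_infDist_pos hne).2 hx'
  rw [← sub_le_iff_le_add]
  refine le_hausdorffExtend hne a hxK fun y => ?_
  rw [sub_le_iff_le_add]
  have herr : 0 ≤ 2 * dist x x' * (C + 3) / Metric.infDist x K := by positivity
  by_cases hy : dist x y ≤ (C + 2) * Metric.infDist x K
  · refine (hausdorffExtend_le h0 a hx' hx'K y).trans ?_
    have htri : dist x' y ≤ dist x x' + dist x y := by
      rw [dist_comm x x']; exact dist_triangle _ _ _
    have key : dist x' y / Metric.infDist x' K ≤
        dist x y / Metric.infDist x K + 2 * dist x x' * (C + 3) / Metric.infDist x K := by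
      rw [← add_div, div_le_div_iff₀ hx' hx]
      set h := Metric.infDist x K
      set h' := Metric.infDist x' K
      set δ := dist x x'
      set r := dist x y
      have hr : 0 ≤ r := dist_nonneg
      have h1 : dist x' y * h ≤ (δ + r) * h := by gcongr
      have h2 : (r + 2 * δ * (C + 3)) * (h - δ) ≤ (r + 2 * δ * (C + 3)) * h' := by
        apply mul_le_mul_of_nonneg_left (by linarith); positivity
      have h3 : 0 ≤ (δ * (C + 3)) * (h - 2 * δ) :=
        mul_nonneg (by positivity) (by linarith)
      have h4 : δ * r ≤ δ * ((C + 2) * h) := by gcongr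
      nlinarith
    linarith
  · have h1 : C + 2 ≤ dist x y / Metric.infDist x K := by
      rw [le_div_iff₀ hx]; exact (not_le.1 hy).le
    linarith [(hausdorffExtend_mem_Icc hK hne h0 hC a x').2, h0 a y]

theorem equicontinuous_hausdorffExtend (hK : IsClosed K) (hne : K.Nonempty)
    (h0 : ∀ x y, 0 ≤ e x y) (hC : ∀ x y, e x y ≤ C) (hsymm : ∀ x y, e x y = e y x)
    (htri : ∀ x y z, e x z ≤ e x y + e y z)
    (hcont : ∀ x : K, ∀ ε > 0, ∃ δ > 0, ∀ y : K, dist x y < δ → e x y < ε)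
    (x : X) {ε : ℝ} (hε : 0 < ε) :
    ∃ δ > 0, ∀ x', dist x x' < δ →
      ∀ a, |hausdorffExtend K e a x - hausdorffExtend K e a x'| ≤ ε := by
  obtain ⟨a₀, ha₀⟩ := hne
  have hC0 : 0 ≤ C := (h0 ⟨a₀, ha₀⟩ ⟨a₀, ha₀⟩).trans (hC _ _)
  replace hne : K.Nonempty := ⟨a₀, ha₀⟩
  by_cases hxK : x ∈ K
  · lift x to K using hxK
    obtain ⟨δ, hδ, hδε⟩ := hcont x (ε / 2) (by positivity)
    refine ⟨δ / (C + 4), by positivity, fun x' hxx' a => ?_⟩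
    rw [lt_div_iff₀ (by positivity)] at hxx'
    have hd : (0 : ℝ) ≤ dist (x : X) x' := dist_nonneg
    rw [hausdorffExtend_coe, abs_sub_le_iff]
    by_cases hx'K : x' ∈ K
    · lift x' to K using hx'K
      rw [hausdorffExtend_coe]
      have := hδε x' (by rw [Subtype.dist_eq]; nlinarith)
      have h1 := htri a x x'
      have h2 := htri a x' x
      rw [hsymm x' x] at h2
      constructor <;> linarith
    · have hx' := (hK.notMem_iff_infDist_pos hne).1 hx'K
      have hh : Metric.infDist x' K ≤ dist (x : X) x' := by
        rw [dist_comm]; exact Metric.infDist_le_dist_of_mem x.2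
      have near : ∀ y : K, dist x' y ≤ (C + 2) * Metric.infDist x' K → e x y < ε / 2 := by
        intro y hy
        apply hδε
        rw [Subtype.dist_eq]
        have := dist_triangle (x : X) x' y
        nlinarith
      constructor
      · rw [sub_le_comm]
        refine le_hausdorffExtend hne a hx'K fun y => ?_
        by_cases hy : dist x' y ≤ (C + 2) * Metric.infDist x' K
        · have h1 := near y hy
          have h2 := htri a y x
          rw [hsymm y x] at h2
          linarith [one_le_dist_div_infDist hx' y]
        · have h1 : C + 2 ≤ dist x' y / Metric.infDist x' K := by
            rw [le_div_iff₀ hx']; exact (not_le.1 hy).le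
          linarith [hC a x, h0 a y]
      · obtain ⟨y, hy, hy'⟩ := exists_dist_div_infDist_lt (η := min (ε / 2) 1) hne hx'
          (by positivity)
        have h1 := near y (hy.le.trans (mul_le_mul_of_nonneg_right
          (by linarith [min_le_right (ε / 2) 1]) hx'.le))
        linarith [hausdorffExtend_le h0 a hx' hx'K y, htri a x y, min_le_left (ε / 2) 1]
  · have hx := (hK.notMem_iff_infDist_pos hne).1 hxK
    set h := Metric.infDist x K
    refine ⟨min (h / 4) (ε * h / (4 * (C + 3))), by positivity, fun x' hxx' a => ?_⟩
    obtain ⟨hd1, hd2⟩ := lt_min_iff.1 hxx'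
    rw [lt_div_iff₀ (by positivity)] at hd2
    have hd : (0 : ℝ) ≤ dist x x' := dist_nonneg
    have hlip : h ≤ Metric.infDist x' K + dist x x' := Metric.infDist_le_infDist_add_dist
    have hx' : 0 < Metric.infDist x' K := by linarith
    have h1 := hausdorffExtend_le_add hK hne h0 hC a hx (x' := x') (by linarith)
    have h2 := hausdorffExtend_le_add hK hne h0 hC a hx' (x' := x) (by
      rw [dist_comm]; linarith)
    have h3 : 2 * dist x x' * (C + 3) / h ≤ ε := by
      rw [div_le_iff₀ hx]; nlinarith
    have h4 : 2 * dist x' x * (C + 3) / Metric.infDist x' K ≤ ε := by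
      rw [div_le_iff₀ hx', dist_comm x' x]; nlinarith
    rw [abs_sub_le_iff]
    constructor <;> linarith

end hausdorffExtend

/-- A bounded continuous pseudometric on a closed subset extends to a continuous pseudometric. -/
theorem exists_continuous_pseudoMetric_extension {X : Type*} [MetricSpace X] {K : Set X}
    {e : K → K → ℝ} {C : ℝ} (hK : IsClosed K) (hne : K.Nonempty)
    (he : IsPseudoMetric e) (hC : ∀ x y, e x y ≤ C)
    (hcont : ∀ x : K, ∀ ε > 0, ∃ δ > 0, ∀ y : K, dist x y < δ → e x y < ε) :
    ∃ p : X → X → ℝ, IsPseudoMetric p ∧ (∀ x y : K, p x y = e x y) ∧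
      ∀ x : X, ∀ ε > 0, ∃ δ > 0, ∀ y, dist x y < δ → p x y < ε := by
  have := hne.to_subtype
  set f := hausdorffExtend K e
  have hbdd : ∀ x y, BddAbove (Set.range fun a => |f a x - f a y|) := by
    intro x y
    refine ⟨C + 1, ?_⟩
    rintro _ ⟨a, rfl⟩
    have hx := hausdorffExtend_mem_Icc hK hne he.nonneg hC a x
    have hy := hausdorffExtend_mem_Icc hK hne he.nonneg hC a y
    exact abs_sub_le_iff.2 ⟨by linarith, by linarith⟩
  refine ⟨fun x y => ⨆ a, |f a x - f a y|,
          { self := fun x => by simp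
            comm := fun x y => by simp only [abs_sub_comm]
            triangle := fun x y z => ciSup_le fun a => (abs_sub_le _ (f a y) _).trans
              (add_le_add (le_ciSup (hbdd x y) a) (le_ciSup (hbdd y z) a)) }, ?_, ?_⟩
  · intro x y
    change ⨆ a, |f a x - f a y| = e x y
    simp only [f, hausdorffExtend_coe]
    apply le_antisymm
    · refine ciSup_le fun a => abs_sub_le_iff.2 ⟨?_, ?_⟩
      · linarith [he.triangle a y x, he.comm x y]
      · linarith [he.triangle a x y]
    · have := le_ciSup (hbdd x y) x
      simp only [f, hausdorffExtend_coe, he.self, zero_sub, abs_neg] at this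
      exact (le_abs_self _).trans this
  · intro x ε hε
    obtain ⟨δ, hδ, h⟩ := equicontinuous_hausdorffExtend hK hne he.nonneg hC he.comm he.triangle hcont x
      (half_pos hε)
    refine ⟨δ, hδ, fun y hy => ?_⟩
    exact (ciSup_le (h y hy)).trans_lt (half_lt_self hε)

theorem MetricSpace.topology_eq_of_forall_exists {X : Type*} (m₁ m₂ : MetricSpace X)
    (h₁ : ∀ x, ∀ ε > 0, ∃ δ > 0, ∀ y, m₁.dist x y < δ → m₂.dist x y < ε)
    (h₂ : ∀ x, ∀ ε > 0, ∃ δ > 0, ∀ y, m₂.dist x y < δ → m₁.dist x y < ε) :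
    m₁.toUniformSpace.toTopologicalSpace = m₂.toUniformSpace.toTopologicalSpace := by
  have key : ∀ m₁ m₂ : MetricSpace X,
      (∀ x, ∀ ε > 0, ∃ δ > 0, ∀ y, m₁.dist x y < δ → m₂.dist x y < ε) →
      m₁.toUniformSpace.toTopologicalSpace ≤ m₂.toUniformSpace.toTopologicalSpace := by
    intro m₁ m₂ h
    rw [← continuous_id_iff_le]
    refine (@Metric.continuous_iff X X m₁.toPseudoMetricSpace m₂.toPseudoMetricSpace id).2 ?_
    intro x ε hε
    obtain ⟨δ, hδ, hy⟩ := h x ε hε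
    refine ⟨δ, hδ, fun y hyx => ?_⟩
    have := hy y (by rw [m₁.dist_comm]; exact hyx)
    rw [m₂.dist_comm] at this
    exact this
  exact le_antisymm (key _ _ h₁) (key _ _ h₂)

/-- A pseudometric function uniformly comparable at every point to a metric, whose Cauchy sequences
all converge, is a complete metric with the same topology. -/
theorem IsPseudoMetric.exists_complete_metric {X : Type*} [m : MetricSpace X] {D : X → X → ℝ}
    (hD : IsPseudoMetric D)
    (hfine : ∀ x, ∀ ε > 0, ∃ δ > 0, ∀ y, D x y < δ → dist x y < ε)
    (hcoarse : ∀ x, ∀ ε > 0, ∃ δ > 0, ∀ y, dist x y < δ → D x y < ε)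
    (hcomplete : ∀ u : ℕ → X, (∀ ε > 0, ∃ N, ∀ i ≥ N, ∀ j ≥ N, D (u i) (u j) < ε) →
      ∃ x, Tendsto u atTop (𝓝 x)) :
    ∃ d : MetricSpace X,
      d.toUniformSpace.toTopologicalSpace = m.toUniformSpace.toTopologicalSpace ∧
      @CompleteSpace X d.toUniformSpace ∧ ∀ x y, d.dist x y = D x y := by
  have hsep : ∀ x y, D x y = 0 → x = y := fun x y hxy =>
    eq_of_forall_dist_le fun ε hε => by
      obtain ⟨δ, hδ, hy⟩ := hfine x ε hε
      exact (hy y (hxy ▸ hδ)).le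
  let d : MetricSpace X :=
    { dist := D
      dist_self := hD.self
      dist_comm := hD.comm
      dist_triangle := hD.triangle
      eq_of_dist_eq_zero := fun {x y} => hsep x y }
  have htop : d.toUniformSpace.toTopologicalSpace = m.toUniformSpace.toTopologicalSpace :=
    MetricSpace.topology_eq_of_forall_exists d m hfine hcoarse
  refine ⟨d, htop, ?_, fun x y => rfl⟩
  refine @Metric.complete_of_cauchySeq_tendsto X d.toPseudoMetricSpace fun u hu => ?_
  rw [htop]
  exact hcomplete u ((@Metric.cauchySeq_iff X ℕ d.toPseudoMetricSpace _ _ u).1 hu)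

/-- A continuous pseudometric can be added to a complete metric. -/
theorem exists_complete_metric_ge_pseudoMetric {X : Type*} [m : MetricSpace X]
    [CompleteSpace X] {p : X → X → ℝ} (hpm : IsPseudoMetric p)
    (hp : ∀ x : X, ∀ ε > 0, ∃ δ > 0, ∀ y, dist x y < δ → p x y < ε) :
    ∃ d : MetricSpace X,
      d.toUniformSpace.toTopologicalSpace = m.toUniformSpace.toTopologicalSpace ∧
      @CompleteSpace X d.toUniformSpace ∧ ∀ x y, p x y ≤ d.dist x y := by
  have hle : ∀ x y, dist x y ≤ dist x y + p x y := fun x y =>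
    le_add_of_nonneg_right (hpm.nonneg x y)
  have hple : ∀ x y, p x y ≤ dist x y + p x y := fun x y => le_add_of_nonneg_left dist_nonneg
  have hD : IsPseudoMetric fun x y => dist x y + p x y :=
    { self := fun x => by rw [dist_self, hpm.self, add_zero]
      comm := fun x y => by rw [dist_comm, hpm.comm]
      triangle := fun x y z => by linarith [dist_triangle x y z, hpm.triangle x y z] }
  obtain ⟨d, htop, hd, hdD⟩ := hD.exists_complete_metric
    (fun x ε hε => ⟨ε, hε, fun y hy => (hle x y).trans_lt hy⟩)
    (fun x ε hε => by
      obtain ⟨δ, hδ, h⟩ := hp x (ε / 2) (half_pos hε)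
      refine ⟨min δ (ε / 2), by positivity, fun y hy => ?_⟩
      obtain ⟨h1, h2⟩ := lt_min_iff.1 hy
      exact (add_lt_add h2 (h y h1)).trans_eq (add_halves ε))
    (fun u hu => by
      refine cauchySeq_tendsto_of_complete (Metric.cauchySeq_iff.2 fun ε hε => ?_)
      obtain ⟨N, hN⟩ := hu ε hε
      exact ⟨N, fun i hi j hj => (hle _ _).trans_lt (hN i hi j hj)⟩)
  exact ⟨d, htop, hd, fun x y => (hple x y).trans_eq (hdD x y).symm⟩

/-- A pseudometric bounded by a complete metric, whose restriction to the closed set `K` is a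
complete metric inducing the topology of `K`, can be modified off `K` to a complete metric. -/
theorem exists_complete_metric_eq_on_of_pseudoMetric_le {X : Type*} [m : MetricSpace X]
    [CompleteSpace X] {K : Set X} (hK : IsClosed K) (hne : K.Nonempty)
    {p : X → X → ℝ} (hpm : IsPseudoMetric p) (hp : ∀ x y, p x y ≤ dist x y)
    (hcont : ∀ x ∈ K, ∀ ε > 0, ∃ δ > 0, ∀ y ∈ K, p x y < δ → dist x y < ε)
    (hcomplete : ∀ u : ℕ → X, (∀ n, u n ∈ K) →
      (∀ ε > 0, ∃ N, ∀ i ≥ N, ∀ j ≥ N, p (u i) (u j) < ε) →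
      ∃ x, Tendsto u atTop (𝓝 x)) :
    ∃ d : MetricSpace X,
      d.toUniformSpace.toTopologicalSpace = m.toUniformSpace.toTopologicalSpace ∧
      @CompleteSpace X d.toUniformSpace ∧ ∀ x ∈ K, ∀ y ∈ K, d.dist x y = p x y := by
  set h : X → ℝ := fun x => Metric.infDist x K
  have h0 : ∀ x, 0 ≤ h x := fun x => Metric.infDist_nonneg
  have hlip : ∀ x y, h x ≤ h y + dist x y := fun x y => Metric.infDist_le_infDist_add_dist
  have hK0 : ∀ x ∈ K, h x = 0 := fun x hx => Metric.infDist_zero_of_mem hx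
  have hnear : ∀ x, ∀ r > h x, ∃ y ∈ K, dist x y < r := fun x r hr =>
    (Metric.infDist_lt_iff hne).1 hr
  let D : X → X → ℝ := fun x y => max (p x y) (min (dist x y) (h x + h y))
  have hD : ∀ x y, D x y = max (p x y) (min (dist x y) (h x + h y)) := fun _ _ => rfl
  have hDdist : ∀ x y, D x y ≤ dist x y := fun x y => max_le (hp x y) (min_le_left _ _)
  have hpD : ∀ x y, p x y ≤ D x y := fun x y => le_max_left _ _
  have hqD : ∀ x y, min (dist x y) (h x + h y) ≤ D x y := fun x y => le_max_right _ _
  have hhD : ∀ x y, h x ≤ h y + D x y := by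
    intro x y
    have := hqD x y
    rcases min_le_iff.1 this with h' | h'
    · linarith [hlip x y]
    · linarith [h0 y]
  have hfine : ∀ x, ∀ ε > 0, ∃ δ > 0, ∀ y, D x y < δ → dist x y < ε := by
    intro x ε hε
    by_cases hxK : x ∈ K
    · obtain ⟨δ, hδ, hxδ⟩ := hcont x hxK (ε / 2) (half_pos hε)
      refine ⟨min (ε / 2) (δ / 2), by positivity, fun y hy => ?_⟩
      have hhy : h y < min (ε / 2) (δ / 2) := by
        have h1 := hqD x y
        rw [hK0 x hxK, zero_add] at h1
        rcases min_le_iff.1 h1 with h2 | h2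
        · have := hlip y x
          rw [hK0 x hxK, dist_comm] at this
          linarith
        · linarith
      obtain ⟨z, hzK, hyz⟩ := hnear y _ hhy
      obtain ⟨h1, h2⟩ := lt_min_iff.1 hyz
      obtain ⟨h3, h4⟩ := lt_min_iff.1 hy
      have h5 := hxδ z hzK (by linarith [hpm.triangle x y z, hp y z, hpD x y])
      have h6 := dist_triangle x z y
      rw [dist_comm z y] at h6
      linarith
    · have hx : 0 < h x := (hK.notMem_iff_infDist_pos hne).1 hxK
      refine ⟨min ε (h x), lt_min hε hx, fun y hy => ?_⟩
      obtain ⟨h1, h2⟩ := lt_min_iff.1 hy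
      rcases min_le_iff.1 (hqD x y) with h3 | h3
      · linarith
      · linarith [h0 y]
  have hDp : IsPseudoMetric D :=
    { self := fun x => by
        rw [hD, hpm.self, dist_self, min_eq_left (add_nonneg (h0 x) (h0 x)), max_self]
      comm := fun x y => by rw [hD, hD, hpm.comm, dist_comm, add_comm (h x)]
      triangle := fun x y z => by
        rw [hD x z]
        refine max_le ?_ ?_
        · linarith [hpm.triangle x y z, hpD x y, hpD y z]
        · rcases min_le_iff.1 (hqD x y) with h1 | h1
          · rcases min_le_iff.1 (hqD y z) with h2 | h2
            · exact (min_le_left _ _).trans ((dist_triangle x y z).trans (add_le_add h1 h2))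
            · exact (min_le_right _ _).trans (by linarith [hlip x y])
          · refine (min_le_right _ _).trans ?_
            have h2 := hhD z y
            have h3 : D z y = D y z := by rw [hD, hD, hpm.comm, dist_comm, add_comm (h z)]
            linarith }
  have hDK : ∀ x ∈ K, ∀ y ∈ K, D x y = p x y := fun x hx y hy => by
    rw [hD, hK0 x hx, hK0 y hy, add_zero, min_eq_right dist_nonneg,
      max_eq_left (hpm.nonneg x y)]
  have hconv : ∀ u : ℕ → X, (∀ ε > 0, ∃ N, ∀ i ≥ N, ∀ j ≥ N, D (u i) (u j) < ε) →
      ∃ x, Tendsto u atTop (𝓝 x) := by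
    intro u hu
    by_cases hc : ∃ c > 0, ∃ N, ∀ n ≥ N, c ≤ h (u n)
    · obtain ⟨c, hc, N, hN⟩ := hc
      refine cauchySeq_tendsto_of_complete (Metric.cauchySeq_iff.2 fun ε hε => ?_)
      obtain ⟨M, hM⟩ := hu (min ε c) (lt_min hε hc)
      refine ⟨max N M, fun i hi j hj => ?_⟩
      obtain ⟨h1, h2⟩ := lt_min_iff.1
        (hM i (le_of_max_le_right hi) j (le_of_max_le_right hj))
      rcases min_le_iff.1 (hqD (u i) (u j)) with h3 | h3
      · linarith
      · linarith [h0 (u j), hN i (le_of_max_le_left hi)]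
    · push Not at hc
      have hlim : ∀ c > 0, ∃ N, ∀ n ≥ N, h (u n) < c := by
        intro c hc'
        obtain ⟨N, hN⟩ := hu (c / 2) (half_pos hc')
        obtain ⟨k, hk, hkc⟩ := hc (c / 2) (half_pos hc') N
        exact ⟨N, fun n hn => by linarith [hhD (u n) (u k), hN n hn k hk]⟩
      have hv : ∀ n : ℕ, ∃ y ∈ K, dist (u n) y < h (u n) + 1 / ((n : ℝ) + 1) := fun n =>
        hnear _ _ (lt_add_of_pos_right _ Nat.one_div_pos_of_nat)
      choose v hvK huv using hv
      have huv0 : Tendsto (fun n => dist (u n) (v n)) atTop (𝓝 0) := by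
        have hhu : Tendsto (fun n => h (u n)) atTop (𝓝 0) := by
          refine Metric.tendsto_atTop.2 fun c hc' => ?_
          obtain ⟨N, hN⟩ := hlim c hc'
          refine ⟨N, fun n hn => ?_⟩
          rw [Real.dist_0_eq_abs, abs_of_nonneg (h0 _)]
          exact hN n hn
        have := hhu.add tendsto_one_div_add_atTop_nhds_zero_nat
        rw [add_zero] at this
        exact squeeze_zero (fun _ => dist_nonneg) (fun n => (huv n).le) this
      obtain ⟨x, hx⟩ := hcomplete v hvK (by
        intro ε hε
        obtain ⟨N, hN⟩ := hu (ε / 3) (by positivity)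
        obtain ⟨M, hM⟩ := Metric.tendsto_atTop.1 huv0 (ε / 3) (by positivity)
        refine ⟨max N M, fun i hi j hj => ?_⟩
        have h1 := hN i (le_of_max_le_left hi) j (le_of_max_le_left hj)
        have h2 := hM i (le_of_max_le_right hi)
        have h3 := hM j (le_of_max_le_right hj)
        rw [Real.dist_0_eq_abs, abs_of_nonneg dist_nonneg] at h2 h3
        have h4 := hpm.triangle (v i) (u i) (v j)
        have h5 := hpm.triangle (u i) (u j) (v j)
        rw [hpm.comm (v i) (u i)] at h4
        linarith [hp (u i) (v i), hp (u j) (v j), hpD (u i) (u j)])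
      refine ⟨x, tendsto_iff_dist_tendsto_zero.2 ?_⟩
      have := huv0.add (tendsto_iff_dist_tendsto_zero.1 hx)
      rw [add_zero] at this
      exact squeeze_zero (fun _ => dist_nonneg) (fun n => dist_triangle _ (v n) _) this
  obtain ⟨d, htop, hd, hdD⟩ := hDp.exists_complete_metric hfine
    (fun x ε hε => ⟨ε, hε, fun y hy => (hDdist x y).trans_lt hy⟩)
    hconv
  exact ⟨d, htop, hd, fun x hx y hy => (hdD x y).trans (hDK x hx y hy)⟩

/-- Let `X` be a completely metrizable topological space, `K ⊆ X` closed,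
and `d_K` a complete metric on `K` compatible with the subspace topology such that `K`
has finite `d_K`-diameter. Then there is a complete metric on `X` compatible with the
topology of `X` whose restriction to `K × K` is `d_K`. -/
theorem stmt19 {X : Type} [t : TopologicalSpace X]
    (hX : ∃ m : MetricSpace X, m.toUniformSpace.toTopologicalSpace = t ∧
      @CompleteSpace X m.toUniformSpace)
    (K : Set X) (hK : IsClosed K) (dK : MetricSpace K)
    (hcompat : dK.toUniformSpace.toTopologicalSpace = (inferInstance : TopologicalSpace K))
    (hcomplete : @CompleteSpace K dK.toUniformSpace)
    (hbdd : ∃ C : ℝ, ∀ x y : K, dK.dist x y ≤ C) :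
    ∃ d : MetricSpace X, d.toUniformSpace.toTopologicalSpace = t ∧
      @CompleteSpace X d.toUniformSpace ∧
      ∀ x y : K, d.dist x.1 y.1 = dK.dist x y := by
  obtain ⟨m, rfl, hm⟩ := hX
  rcases K.eq_empty_or_nonempty with rfl | hne
  · exact ⟨m, rfl, hm, fun x => x.2.elim⟩
  obtain ⟨C, hC⟩ := hbdd
  have nhds_eq : ∀ x : K, @nhds K dK.toUniformSpace.toTopologicalSpace x = 𝓝 x := by
    intro x
    rw [hcompat]
  have hdK : ∀ x : K, ∀ ε > 0, ∃ δ > 0, ∀ y : K, m.dist x y < δ → dK.dist x y < ε := by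
    intro x ε hε
    have h := @Metric.ball_mem_nhds K dK.toPseudoMetricSpace x ε hε
    rw [nhds_eq] at h
    obtain ⟨δ, hδ, hsub⟩ := Metric.mem_nhds_iff.1 h
    refine ⟨δ, hδ, fun y hy => ?_⟩
    rw [dK.dist_comm]
    exact hsub (Metric.mem_ball'.2 hy)
  obtain ⟨p, hpm, hpK, hp⟩ := exists_continuous_pseudoMetric_extension (e := dK.dist) (C := C) hK hne
    ⟨dK.dist_self, dK.dist_comm, dK.dist_triangle⟩ hC hdK
  have hfine : ∀ x : K, ∀ s ∈ 𝓝 (x : X), ∃ δ > 0, ∀ y : K, dK.dist x y < δ → (y : X) ∈ s := by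
    intro x s hs
    have h : Subtype.val ⁻¹' s ∈ @nhds K dK.toUniformSpace.toTopologicalSpace x := by
      rw [nhds_eq]
      exact continuous_subtype_val.continuousAt.preimage_mem_nhds hs
    obtain ⟨δ, hδ, hsub⟩ := (@Metric.mem_nhds_iff K dK.toPseudoMetricSpace _ _).1 h
    exact ⟨δ, hδ, fun y hy => hsub ((@Metric.mem_ball' K dK.toPseudoMetricSpace _ _ _).2 hy)⟩
  have hconv : ∀ v : ℕ → K, @CauchySeq K ℕ dK.toUniformSpace _ v →
      ∃ x, Tendsto (fun n => (v n : X)) atTop (𝓝 x) := by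
    intro v hv
    obtain ⟨x, hx⟩ := @cauchySeq_tendsto_of_complete K ℕ dK.toUniformSpace _ hcomplete v hv
    rw [nhds_eq] at hx
    exact ⟨x, (continuous_subtype_val.tendsto x).comp hx⟩
  obtain ⟨m', htop, hm', hpm'⟩ := exists_complete_metric_ge_pseudoMetric hpm hp
  rw [← htop] at hK hfine hconv
  obtain ⟨d, hd, hdc, hdp⟩ := exists_complete_metric_eq_on_of_pseudoMetric_le hK hne hpm hpm'
    (fun x hx ε hε => by
      obtain ⟨δ, hδ, hxδ⟩ := hfine ⟨x, hx⟩ _ (Metric.ball_mem_nhds x hε)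
      refine ⟨δ, hδ, fun y hy hxy => ?_⟩
      exact Metric.mem_ball'.1 (hxδ ⟨y, hy⟩ ((hpK ⟨x, hx⟩ ⟨y, hy⟩).symm.trans_lt hxy)))
    (fun u huK hu => by
      let v : ℕ → K := fun n => ⟨u n, huK n⟩
      refine hconv v ((@Metric.cauchySeq_iff K ℕ dK.toPseudoMetricSpace _ _ v).2 fun ε hε => ?_)
      obtain ⟨N, hN⟩ := hu ε hε
      exact ⟨N, fun i hi j hj => (hpK (v i) (v j)).symm.trans_lt (hN i hi j hj)⟩)
  exact ⟨d, hd.trans htop, hdc, fun x y => (hdp x x.2 y y.2).trans (hpK x y)⟩
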